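/- Let n be a positive integer, let ρ ∈ (0,1] be such that k = ρn is a positive integer, and define α(k, n) = (1/k) Σ_{i=1}^k E(X_i), where X_i is the positive square root of a chi-square random variable with n − i + 1 degrees of freedom. Then 1/α(ρn, n) ≤ (1 + ρ/2)/√n. -/

import Mathlib

open MeasureTheory ProbabilityTheory

/-- The expectation of the positive square root of a chi-square random variable with `p`
degrees of freedom; chi-square with `p` degrees of freedom is the Gamma distribution with
shape `p/2` and rate `1/2`. -/
noncomputable def chiSqrtMoment (p : ℝ) : ℝ :=
  ∫ x, Real.sqrt x ∂(gammaMeasure (p / 2) (1 / 2))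

/-- The constant `α(k, n) = (1/k) Σ_{i=1}^k E(X_i)` where `X_i²` is chi-square with
`n - i + 1` degrees of freedom. -/
noncomputable def alphaConst (k n : ℕ) : ℝ :=
  (1 / (k : ℝ)) * ∑ i ∈ Finset.Icc 1 k, chiSqrtMoment ((n : ℝ) - (i : ℝ) + 1)

theorem integral_sqrt_gammaMeasure {a r : ℝ} (ha : 0 < a) (hr : 0 < r) :
    ∫ x, Real.sqrt x ∂(gammaMeasure a r) =
      Real.Gamma (a + 1 / 2) / (Real.Gamma a * Real.sqrt r) := by
  have hGa := Real.Gamma_pos_of_pos ha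
  have hsr := Real.sqrt_pos.2 hr
  have hmeas : Measurable (gammaPDF a r) := (measurable_gammaPDFReal a r).ennreal_ofReal
  have hpdf : ∀ x, (gammaPDF a r x).toReal • Real.sqrt x = (Set.Ioi (0 : ℝ)).indicator
      (fun x ↦ r ^ a / Real.Gamma a * (x ^ (a + 1 / 2 - 1) * Real.exp (-(r * x)))) x := by
    intro x
    rw [gammaPDF, ENNReal.toReal_ofReal (gammaPDFReal_nonneg ha hr x), smul_eq_mul]
    by_cases hx : 0 < x
    · rw [Set.indicator_of_mem (Set.mem_Ioi.2 hx), gammaPDFReal, if_pos hx.le,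
        Real.sqrt_eq_rpow, show a + 1 / 2 - 1 = (a - 1) + 1 / 2 by ring, Real.rpow_add hx]
      ring
    · rw [Set.indicator_of_notMem (by simpa using hx), Real.sqrt_eq_zero_of_nonpos (not_lt.1 hx),
        mul_zero]
  rw [gammaMeasure, integral_withDensity_eq_integral_toReal_smul hmeas
    (ae_of_all _ fun _ ↦ ENNReal.ofReal_lt_top), integral_congr_ae (ae_of_all _ hpdf),
    integral_indicator measurableSet_Ioi, integral_const_mul,
    Real.integral_rpow_mul_exp_neg_mul_Ioi (by positivity) hr, one_div r,
    Real.inv_rpow hr.le, Real.rpow_add hr, ← Real.sqrt_eq_rpow]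
  have := Real.rpow_pos_of_pos hr a
  field_simp

theorem chiSqrtMoment_eq {p : ℝ} (hp : 0 < p) :
    chiSqrtMoment p = Real.sqrt 2 * Real.Gamma (p / 2 + 1 / 2) / Real.Gamma (p / 2) := by
  have := Real.Gamma_pos_of_pos (half_pos hp)
  rw [chiSqrtMoment, integral_sqrt_gammaMeasure (half_pos hp) one_half_pos, one_div (2 : ℝ),
    Real.sqrt_inv]
  field_simp

theorem sub_half_mul_Gamma_sq_le {x : ℝ} (hx : 1 / 2 < x) :
    (x - 1 / 2) * Real.Gamma x ^ 2 ≤ Real.Gamma (x + 1 / 2) ^ 2 := by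
  have hs : 0 < x - 1 / 2 := by linarith
  have hs' : 0 < x + 1 / 2 := by linarith
  have hG := Real.Gamma_pos_of_pos hs
  have hG' := Real.Gamma_pos_of_pos hs'
  have h := Real.Gamma_mul_add_mul_le_rpow_Gamma_mul_rpow_Gamma hs hs'
    (one_half_pos (α := ℝ)) one_half_pos (by norm_num)
  rw [show 1 / 2 * (x - 1 / 2) + 1 / 2 * (x + 1 / 2) = x by ring, ← Real.sqrt_eq_rpow,
    ← Real.sqrt_eq_rpow, ← Real.sqrt_mul hG.le] at h
  have hsq : Real.Gamma x ^ 2 ≤ Real.Gamma (x - 1 / 2) * Real.Gamma (x + 1 / 2) :=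
    (Real.le_sqrt (Real.Gamma_pos_of_pos (by linarith)).le (by positivity)).1 h
  have hrec : Real.Gamma (x + 1 / 2) = (x - 1 / 2) * Real.Gamma (x - 1 / 2) := by
    rw [← Real.Gamma_add_one hs.ne']
    ring_nf
  calc (x - 1 / 2) * Real.Gamma x ^ 2
      ≤ (x - 1 / 2) * (Real.Gamma (x - 1 / 2) * Real.Gamma (x + 1 / 2)) := by gcongr
    _ = Real.Gamma (x + 1 / 2) ^ 2 := by rw [← mul_assoc, ← hrec, sq]

open Filter Topology in
theorem sub_quarter_mul_Gamma_sq_le {x : ℝ} (hx : 1 / 2 ≤ x) :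
    (x - 1 / 4) * Real.Gamma x ^ 2 ≤ Real.Gamma (x + 1 / 2) ^ 2 := by
  set f : ℝ → ℝ := fun y ↦ Real.Gamma (y + 1 / 2) ^ 2 / ((y - 1 / 4) * Real.Gamma y ^ 2) with hf
  have hstep : ∀ y : ℝ, 1 / 2 ≤ y → f (y + 1) ≤ f y := by
    intro y hy
    have h0 := Real.Gamma_pos_of_pos (show 0 < y by linarith)
    have h1 : 0 < y - 1 / 4 := by linarith
    have h2 : 0 < y + 1 - 1 / 4 := by linarith
    simp only [hf]
    rw [show y + 1 + 1 / 2 = (y + 1 / 2) + 1 by ring,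
      Real.Gamma_add_one (show y + 1 / 2 ≠ 0 by linarith),
      Real.Gamma_add_one (show y ≠ 0 by linarith),
      div_le_div_iff₀ (by positivity) (by positivity)]
    have : (y + 1 / 2) ^ 2 * (y - 1 / 4) ≤ (y + 1 - 1 / 4) * y ^ 2 := by nlinarith
    have := mul_le_mul_of_nonneg_right this
      (show 0 ≤ Real.Gamma (y + 1 / 2) ^ 2 * Real.Gamma y ^ 2 by positivity)
    linarith
  have hle : ∀ j : ℕ, f (x + j) ≤ f x := by
    intro j
    induction j with
    | zero => simp
    | succ j ih =>
      refine le_trans ?_ ih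
      rw [Nat.cast_succ, ← add_assoc]
      exact hstep _ (by linarith [j.cast_nonneg (α := ℝ)])
  have hlow : ∀ j : ℕ, 1 ≤ j → 1 - 1 / (j : ℝ) ≤ f x := by
    intro j hj
    have hj' : (1 : ℝ) ≤ j := by exact_mod_cast hj
    refine le_trans ?_ (hle j)
    have h0 := Real.Gamma_pos_of_pos (show 0 < x + j by linarith)
    have h1 : 0 < x + j - 1 / 4 := by linarith
    have h2 := sub_half_mul_Gamma_sq_le (show 1 / 2 < x + j by linarith)
    simp only [hf]
    rw [le_div_iff₀ (by positivity)]
    refine le_trans ?_ h2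
    rw [← mul_assoc]
    gcongr
    have : 1 ≤ 1 / (j : ℝ) * (x + j - 1 / 4) := by
      rw [one_div, ← div_eq_inv_mul, one_le_div (by linarith)]
      linarith
    linarith
  have hlim : Tendsto (fun j : ℕ ↦ 1 - 1 / (j : ℝ)) atTop (𝓝 1) := by
    simpa using tendsto_const_nhds.sub (tendsto_one_div_atTop_nhds_zero_nat (𝕜 := ℝ))
  have h1 : 1 ≤ f x := le_of_tendsto hlim (eventually_atTop.2 ⟨1, hlow⟩)
  have h0 := Real.Gamma_pos_of_pos (show 0 < x by linarith)
  have h2 : 0 < x - 1 / 4 := by linarith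
  simpa [hf] using (one_le_div (by positivity)).1 h1

theorem sqrt_sub_half_le_chiSqrtMoment {p : ℝ} (hp : 1 ≤ p) :
    Real.sqrt (p - 1 / 2) ≤ chiSqrtMoment p := by
  have h0 := Real.Gamma_pos_of_pos (show 0 < p / 2 by linarith)
  have h1 := Real.Gamma_pos_of_pos (show 0 < p / 2 + 1 / 2 by linarith)
  rw [chiSqrtMoment_eq (by linarith)]
  apply Real.sqrt_le_iff.2 ⟨by positivity, ?_⟩
  rw [div_pow, mul_pow, Real.sq_sqrt zero_le_two, le_div_iff₀ (by positivity)]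
  linarith [sub_quarter_mul_Gamma_sq_le (show 1 / 2 ≤ p / 2 by linarith)]

/-- The integral of the square root over `[p - 1, p]` is at most its midpoint value. -/
theorem mul_sqrt_sub_mul_sqrt_le {p : ℝ} (hp : 1 ≤ p) :
    2 / 3 * (p * Real.sqrt p - (p - 1) * Real.sqrt (p - 1)) ≤ Real.sqrt (p - 1 / 2) := by
  have ha : Real.sqrt p ^ 2 = p := Real.sq_sqrt (by linarith)
  have hb : Real.sqrt (p - 1) ^ 2 = p - 1 := Real.sq_sqrt (by linarith)
  have ha0 : 0 < Real.sqrt p := Real.sqrt_pos.2 (by linarith)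
  have hb0 := Real.sqrt_nonneg (p - 1)
  set a := Real.sqrt p
  set b := Real.sqrt (p - 1)
  have hab : a ^ 2 - b ^ 2 = 1 := by linarith
  apply Real.le_sqrt_of_sq_le
  have hcube : (p * a - (p - 1) * b) * (a + b) = a ^ 2 + a * b + b ^ 2 := by
    rw [← hb, ← ha]
    linear_combination (a ^ 2 + a * b + b ^ 2) * hab
  have hp2 : p - 1 / 2 = (a ^ 2 + b ^ 2) / 2 := by linarith
  refine le_of_mul_le_mul_right ?_ (show 0 < (a + b) ^ 2 by positivity)
  rw [← mul_pow, mul_assoc, hcube, hp2]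
  nlinarith [sq_nonneg (a - b), sq_nonneg (a + b), mul_nonneg ha0.le hb0,
    sq_nonneg (a ^ 2 - b ^ 2), sq_nonneg ((a - b) ^ 2),
    mul_nonneg (mul_nonneg ha0.le hb0) (sq_nonneg (a - b))]

theorem le_sum_chiSqrtMoment {n k : ℕ} (hk : k ≤ n) :
    2 / 3 * (n * Real.sqrt n - (n - k) * Real.sqrt (n - k)) ≤
      ∑ i ∈ Finset.Icc 1 k, chiSqrtMoment ((n : ℝ) - (i : ℝ) + 1) := by
  induction k with
  | zero => simp
  | succ k ih =>
    have hnk : (k : ℝ) + 1 ≤ n := by exact_mod_cast hk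
    have hp : 1 ≤ (n : ℝ) - k := by linarith
    have h := (mul_sqrt_sub_mul_sqrt_le hp).trans (sqrt_sub_half_le_chiSqrtMoment hp)
    rw [Finset.sum_Icc_succ_top (by omega), Nat.cast_succ, ← sub_sub, sub_add_cancel]
    linarith [ih (by omega)]

theorem le_mul_one_sub_mul_sqrt {ρ : ℝ} (hρ0 : 0 ≤ ρ) (hρ1 : ρ ≤ 1) :
    ρ ≤ (1 + ρ / 2) * (2 / 3 * (1 - (1 - ρ) * Real.sqrt (1 - ρ))) := by
  have hs : Real.sqrt (1 - ρ) ^ 2 = 1 - ρ := Real.sq_sqrt (by linarith)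
  have hs0 := Real.sqrt_nonneg (1 - ρ)
  have hs1 : Real.sqrt (1 - ρ) ≤ 1 := Real.sqrt_le_one.2 (by linarith)
  generalize Real.sqrt (1 - ρ) = s at *
  obtain rfl : ρ = 1 - s ^ 2 := by linarith
  have h : 0 ≤ s ^ 2 * ((1 - s) ^ 2 * (s + 2)) := by positivity
  linarith

/-- **Reciprocal bound for the constant.**  If `k = ρ n` with `ρ ∈ (0,1]` and `k, n`
positive integers, then `1/α(ρn, n) ≤ (1 + ρ/2)/√n`. -/
theorem alphaConst_reciprocal_bound (n k : ℕ) (hn : 0 < n) (hk : 0 < k)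
    (ρ : ℝ) (hρ0 : 0 < ρ) (hρ1 : ρ ≤ 1) (hkn : (k : ℝ) = ρ * n) :
    1 / alphaConst k n ≤ (1 + ρ / 2) / Real.sqrt n := by
  have hn' : (0 : ℝ) < n := by exact_mod_cast hn
  have hk' : (0 : ℝ) < k := by exact_mod_cast hk
  have hs := Real.sqrt_pos.2 hn'
  have hkn' : k ≤ n := by
    have : (k : ℝ) ≤ n := by nlinarith
    exact_mod_cast this
  have hsum := le_sum_chiSqrtMoment hkn'
  have hscale : (n : ℝ) * Real.sqrt n - (n - k) * Real.sqrt (n - k) =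
      n * Real.sqrt n * (1 - (1 - ρ) * Real.sqrt (1 - ρ)) := by
    rw [hkn, show (n : ℝ) - ρ * n = n * (1 - ρ) by ring, Real.sqrt_mul hn'.le]
    ring
  rw [hscale] at hsum
  set S := ∑ i ∈ Finset.Icc 1 k, chiSqrtMoment ((n : ℝ) - (i : ℝ) + 1) with hS
  have hmain : k * Real.sqrt n ≤ (1 + ρ / 2) * S :=
    calc k * Real.sqrt n = n * Real.sqrt n * ρ := by rw [hkn]; ring
      _ ≤ n * Real.sqrt n * ((1 + ρ / 2) * (2 / 3 * (1 - (1 - ρ) * Real.sqrt (1 - ρ)))) := by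
        gcongr
        exact le_mul_one_sub_mul_sqrt hρ0.le hρ1
      _ = (1 + ρ / 2) * (2 / 3 * (n * Real.sqrt n * (1 - (1 - ρ) * Real.sqrt (1 - ρ)))) := by ring
      _ ≤ (1 + ρ / 2) * S := by gcongr
  have hSpos : 0 < S :=
    pos_of_mul_pos_right ((mul_pos hk' hs).trans_le hmain) (by positivity)
  rw [alphaConst, ← hS, one_div_mul_eq_div, one_div_div, div_le_div_iff₀ hSpos hs]
  exact hmain
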